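/- Set H₂(P₁,Q₁,P₂,Q₂,u₁,u₂) := −iP₁/u₂ + iP₂Q₁/u₂ + ⅛u₂Q₁²Q₂ + ⅛u₂Q₂² − P₁²Q₂/(2u₂) − P₂²Q₂²/(2u₂) − iP₂u₁/u₂² + u₁³Q₁/(8u₂²) − u₁²Q₁²/(4u₂) + ⅛u₁Q₁³ − (u₁/u₂²)P₁P₂Q₂ − (u₁/(2u₂²))P₁²Q₁ − u₁²Q₂/(8u₂) and h₂(P₁,Q₁,P₂,Q₂,u₁,u₂) := −P₂Q₂/u₂ − P₁Q₁/(2u₂) − u₁P₁/(2u₂²). Then for all P, Q ∈ ℂ and u₂ ∈ ℂ \ {0}, substituting u₁ = 0, P₁ = P, Q₁ = Q, P₂ = 0 and Q₂ = −(u₂²Q² − 4P²)/(2u₂²) gives H₂ = H₀ := −(u₂²Q² − 4P²)²/(32u₂³) − iP/u₂ and h₂ = h₀ := −PQ/(2u₂). Moreover, the Hamiltonian equations of H₀ + h₀, namely ∂P/∂u₂ = −∂(H₀+h₀)/∂Q and ∂Q/∂u₂ = ∂(H₀+h₀)/∂P, coincide with the explicit system ∂P/∂u₂ = Q(u₂²Q²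 − 4P²)/(8u₂) + P/(2u₂), ∂Q/∂u₂ = P(u₂²Q² − 4P²)/(2u₂³) − Q/(2u₂) − i/u₂; i.e. −∂(H₀+h₀)/∂Q = Q(u₂²Q² − 4P²)/(8u₂) + P/(2u₂) and ∂(H₀+h₀)/∂P = P(u₂²Q² − 4P²)/(2u₂³) − Q/(2u₂) − i/u₂ identically in P, Q, u₂ ≠ 0. -/

import Mathlib

open Complex

/-- Second Hamiltonian `H₂` as a rational function of the canonical coordinates and `u₁, u₂`. -/
noncomputable def H2fun (P₁ Q₁ P₂ Q₂ u₁ u₂ : ℂ) : ℂ :=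
  -I * P₁ / u₂ + I * P₂ * Q₁ / u₂ + u₂ * Q₁ ^ 2 * Q₂ / 8 + u₂ * Q₂ ^ 2 / 8
    - P₁ ^ 2 * Q₂ / (2 * u₂) - P₂ ^ 2 * Q₂ ^ 2 / (2 * u₂) - I * P₂ * u₁ / u₂ ^ 2
    + u₁ ^ 3 * Q₁ / (8 * u₂ ^ 2) - u₁ ^ 2 * Q₁ ^ 2 / (4 * u₂) + u₁ * Q₁ ^ 3 / 8
    - (u₁ / u₂ ^ 2) * P₁ * P₂ * Q₂ - (u₁ / (2 * u₂ ^ 2)) * P₁ ^ 2 * Q₁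
    - u₁ ^ 2 * Q₂ / (8 * u₂)

/-- Shift `h₂` of the second Hamiltonian. -/
noncomputable def h2fun (P₁ Q₁ P₂ Q₂ u₁ u₂ : ℂ) : ℂ :=
  -P₂ * Q₂ / u₂ - P₁ * Q₁ / (2 * u₂) - u₁ * P₁ / (2 * u₂ ^ 2)

/-- Reduced Hamiltonian `H₀`. -/
noncomputable def H0fun (P Q u₂ : ℂ) : ℂ :=
  -(u₂ ^ 2 * Q ^ 2 - 4 * P ^ 2) ^ 2 / (32 * u₂ ^ 3) - I * P / u₂

/-- Reduced shift `h₀`. -/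
noncomputable def h0fun (P Q u₂ : ℂ) : ℂ := -P * Q / (2 * u₂)

/-- under `u₁ = 0`, `P₁ = P`, `Q₁ = Q`, `P₂ = 0`,
`Q₂ = −(u₂²Q² − 4P²)/(2u₂²)`, one has `H₂ = H₀` and `h₂ = h₀`; moreover the Hamiltonian
equations of `H₀ + h₀` coincide with the explicit reduced system. -/
theorem stmt17 (P Q u₂ : ℂ) (hu₂ : u₂ ≠ 0) :
    H2fun P Q 0 (-(u₂ ^ 2 * Q ^ 2 - 4 * P ^ 2) / (2 * u₂ ^ 2)) 0 u₂ = H0fun P Q u₂ ∧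
    h2fun P Q 0 (-(u₂ ^ 2 * Q ^ 2 - 4 * P ^ 2) / (2 * u₂ ^ 2)) 0 u₂ = h0fun P Q u₂ ∧
    -deriv (fun q : ℂ => H0fun P q u₂ + h0fun P q u₂) Q
      = Q * (u₂ ^ 2 * Q ^ 2 - 4 * P ^ 2) / (8 * u₂) + P / (2 * u₂) ∧
    deriv (fun p : ℂ => H0fun p Q u₂ + h0fun p Q u₂) P
      = P * (u₂ ^ 2 * Q ^ 2 - 4 * P ^ 2) / (2 * u₂ ^ 3) - Q / (2 * u₂) - I / u₂ := by
  refine ⟨?_, ?_, ?_, ?_⟩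
  · simp only [H2fun, H0fun]
    field_simp
    ring
  · simp only [h2fun, h0fun]
    ring
  · have h₁ : HasDerivAt (fun q : ℂ => u₂ ^ 2 * q ^ 2 - 4 * P ^ 2) (u₂ ^ 2 * (2 * Q)) Q := by
      simpa using ((hasDerivAt_pow 2 Q).const_mul (u₂ ^ 2)).sub_const (4 * P ^ 2)
    have h₂ : HasDerivAt (fun q : ℂ => H0fun P q u₂ + h0fun P q u₂) _ Q :=
      (((h₁.fun_pow 2).fun_neg.div_const (32 * u₂ ^ 3)).sub_const (I * P / u₂)).fun_add
        (((hasDerivAt_id' Q).const_mul (-P)).div_const (2 * u₂))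
    rw [h₂.deriv]
    field_simp
    push_cast
    ring
  · have h₁ : HasDerivAt (fun p : ℂ => u₂ ^ 2 * Q ^ 2 - 4 * p ^ 2) (-(4 * (2 * P))) P := by
      simpa using ((hasDerivAt_pow 2 P).const_mul 4).const_sub (u₂ ^ 2 * Q ^ 2)
    have h₂ : HasDerivAt (fun p : ℂ => H0fun p Q u₂ + h0fun p Q u₂) _ P :=
      (((h₁.fun_pow 2).fun_neg.div_const (32 * u₂ ^ 3)).fun_sub
        (((hasDerivAt_id' P).const_mul I).div_const u₂)).fun_add
        (((hasDerivAt_id' P).fun_neg.mul_const Q).div_const (2 * u₂))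
    rw [h₂.deriv]
    field_simp
    push_cast
    ring
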